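/- The generalized Gaussian Q-function with shaping parameter α = 1/2 (the Gamma-noise case) admits the closed form Q_{1/2}(x) = (1/2)·(1 + √(Λ₀ x))·exp(−√(Λ₀ x)) for every x ≥ 0, where Λ₀ = √120. -/

import Mathlib

open Real MeasureTheory

/-- The generalized Gaussian Q-function
`Q_α(x) = (α Λ₀ / (2 Γ(1/α))) ∫_x^∞ exp(−Λ₀^α t^α) dt`, where
`Λ₀ = √(Γ(3/α)/Γ(1/α))`. -/
noncomputable def ggQ (α x : ℝ) : ℝ :=
  (α * Real.sqrt (Real.Gamma (3 / α) / Real.Gamma (1 / α)) / (2 * Real.Gamma (1 / α))) *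
    ∫ t in Set.Ioi x,
      Real.exp (-(Real.sqrt (Real.Gamma (3 / α) / Real.Gamma (1 / α)) ^ α * t ^ α))

/-- `∫_x^∞ exp(−√(c t)) dt = (2/c)(1 + √(c x)) exp(−√(c x))` for `c > 0` and `x ≥ 0`. -/
theorem integral_Ioi_exp_neg_sqrt_mul {c x : ℝ} (hc : 0 < c) (hx : 0 ≤ x) :
    ∫ t in Set.Ioi x, Real.exp (-Real.sqrt (c * t))
      = 2 / c * ((1 + Real.sqrt (c * x)) * Real.exp (-Real.sqrt (c * x))) := by
  have key := integral_Ioi_of_hasDerivAt_of_nonneg (a := x) (l := 0)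
    (g := fun t => -(2 / c) * ((1 + Real.sqrt (c * t)) * Real.exp (-Real.sqrt (c * t))))
    (g' := fun t => Real.exp (-Real.sqrt (c * t))) ?_ ?_ ?_ ?_
  · rw [key]
    ring
  · exact Continuous.continuousWithinAt (by fun_prop)
  · intro t ht
    have hct : 0 < c * t := mul_pos hc (hx.trans_lt ht)
    have hs : Real.sqrt (c * t) ≠ 0 := (Real.sqrt_pos.mpr hct).ne'
    have h1 : HasDerivAt (fun t => Real.sqrt (c * t)) (c * 1 / (2 * Real.sqrt (c * t))) t :=
      ((hasDerivAt_id t).const_mul c).sqrt hct.ne'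
    have h2 := ((h1.const_add 1).mul h1.neg.exp).const_mul (-(2 / c))
    refine h2.congr_deriv ?_
    simp only [Pi.neg_apply]
    field_simp
    ring
  · exact fun t _ => (Real.exp_pos _).le
  · have h0 : Filter.Tendsto (fun s : ℝ => -(2 / c) * ((1 + s) * Real.exp (-s)))
        Filter.atTop (nhds 0) := by
      have h := ((tendsto_pow_mul_exp_neg_atTop_nhds_zero 0).add
        (tendsto_pow_mul_exp_neg_atTop_nhds_zero 1)).const_mul (-(2 / c))
      simpa [add_mul] using h
    exact h0.comp (Real.tendsto_sqrt_atTop.comp (Filter.tendsto_id.const_mul_atTop hc))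

/-- The generalized Gaussian Q-function with shaping parameter `α = 1/2` (the Gamma-noise case)
admits the closed form `Q_{1/2}(x) = (1/2)(1 + √(Λ₀ x)) exp(−√(Λ₀ x))` for every `x ≥ 0`,
where `Λ₀ = √120`. -/
theorem ggQ_half_eq_gamma_noise (x : ℝ) (hx : 0 ≤ x) :
    ggQ (1 / 2) x
      = (1 / 2) * (1 + Real.sqrt (Real.sqrt 120 * x)) *
          Real.exp (-Real.sqrt (Real.sqrt 120 * x)) := by
  have hc : 0 < Real.sqrt 120 := by positivity
  have hG2 : Real.Gamma (1 / (1 / 2)) = 1 := by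
    norm_num
  have hG6 : Real.Gamma (3 / (1 / 2)) = 120 := by
    rw [show (3 / (1 / 2) : ℝ) = (5 : ℕ) + 1 by norm_num, Real.Gamma_nat_eq_factorial]
    norm_num [Nat.factorial]
  have hint : ∫ t in Set.Ioi x, Real.exp (-(Real.sqrt 120 ^ (1 / 2 : ℝ) * t ^ (1 / 2 : ℝ)))
      = ∫ t in Set.Ioi x, Real.exp (-Real.sqrt (Real.sqrt 120 * t)) := by
    simp only [← Real.sqrt_eq_rpow, ← Real.sqrt_mul hc.le]
  rw [ggQ, hG2, hG6, div_one, hint, integral_Ioi_exp_neg_sqrt_mul hc hx]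
  field_simp
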